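/- arXiv:0811.3787 — 3 statements merged into one kernel-verified Lean document; each statement's English description precedes it below -/
import Mathlib

section
/- Let M and T be as in the context, and assume T satisfies, for all values of the arguments in M: (X) T(T(x,i,j),p,q) + T(T(x,i,p),j,q) + T(T(x,j,q),i,p) + T(T(x,p,q),i,j) = 0; (f₁) T(T(T(x,i,q),j,a),p,a) + T(T(T(x,i,a),j,q),p,a) + T(T(T(x,i,a),j,a),p,q) = 0; and (f₂) T(T(T(x,p,i),j,a),a,q) + T(T(T(x,p,j),i,a),a,q) + T(T(T(x,q,i),j,a),a,p) + T(T(T(x,q,j),i,a),a,p) = 0. Then for all x, a₁, a₂, a₃, a₄, b ∈ M, setting (w₁,…,w₆) = (a₁,a₂,a₃,a₄,b,b), for every permutation σ of {1,…,6} the element T(T(T(x,w_{σ(1)},w_{σ(2)}),w_{σ(3)},w_{σ(4)}),w_{σ(5)},w_{σ(6)}) lies in the 𝔽₃-linear span of the five elements T(T(T(x,a₁,a₂),a₃,b),a₄,b), T(T(T(x,a₁,a₃),a₂,b),a₄,b), T(T(T(x,a₁,a₄),a₂,b),a₃,b), T(T(T(x,a₂,a₃),a₁,b),a₄,b), T(T(T(x,a₁,b),a₂,a₃),a₄,b).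 -/
namespace TernaryWords

variable {M : Type*} [AddCommGroup M] [Module (ZMod 3) M]
  {T : M →ₗ[ZMod 3] M →ₗ[ZMod 3] M →ₗ[ZMod 3] M}

/-- The span of the five words, with the letters `a₁, …, a₄` given by `a : Fin 4 → M`. -/
def wordSpan (T : M →ₗ[ZMod 3] M →ₗ[ZMod 3] M →ₗ[ZMod 3] M) (x b : M) (a : Fin 4 → M) :
    Submodule (ZMod 3) M :=
  Submodule.span (ZMod 3)
    {T (T (T x (a 0) (a 1)) (a 2) b) (a 3) b, T (T (T x (a 0) (a 2)) (a 1) b) (a 3) b,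
      T (T (T x (a 0) (a 3)) (a 1) b) (a 2) b, T (T (T x (a 1) (a 2)) (a 0) b) (a 3) b,
      T (T (T x (a 0) b) (a 1) (a 2)) (a 3) b}

lemma wordSpan_le_iff {x b : M} {a : Fin 4 → M} {N : Submodule (ZMod 3) M} :
    wordSpan T x b a ≤ N ↔
      T (T (T x (a 0) (a 1)) (a 2) b) (a 3) b ∈ N ∧
      T (T (T x (a 0) (a 2)) (a 1) b) (a 3) b ∈ N ∧
      T (T (T x (a 0) (a 3)) (a 1) b) (a 2) b ∈ N ∧
      T (T (T x (a 1) (a 2)) (a 0) b) (a 3) b ∈ N ∧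
      T (T (T x (a 0) b) (a 1) (a 2)) (a 3) b ∈ N := by
  simp [wordSpan, Submodule.span_le, Set.insert_subset_iff]

lemma apply_swap_right (halt : ∀ x y z : M, x = y ∨ y = z ∨ x = z → T x y z = 0) (x y z : M) :
    T x y z = -T x z y := by
  have h := halt x (y + z) (y + z) (by simp)
  simp only [map_add, LinearMap.add_apply, halt x y y (by simp), halt x z z (by simp),
    zero_add, add_zero] at h
  rw [eq_neg_iff_add_eq_zero, add_comm, h]

lemma apply_apply_swap_of_eq (hskew : ∀ x y z : M, T x y z = -T x z y)
    (hX : ∀ x i j p q : M,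
      T (T x i j) p q + T (T x i p) j q + T (T x j q) i p + T (T x p q) i j = 0)
    (x p q b : M) : T (T x q b) p b = -T (T x p b) q b := by
  have h := hX x p b b q
  rw [hskew _ b q, hskew _ b q, map_neg, LinearMap.neg_apply, LinearMap.neg_apply] at h
  have h2 : (2 : ZMod 3) • (T (T x q b) p b + T (T x p b) q b) = 0 := by
    rw [two_smul, ← neg_eq_zero, ← h]
    abel
  exact eq_neg_of_add_eq_zero_left ((smul_eq_zero_iff_right (by decide)).1 h2)

/-- The span of the five words does not depend on the order of the letters `a₁, …, a₄`. -/
lemma wordSpan_comp_perm_le (hskew : ∀ x y z : M, T x y z = -T x z y)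
    (hX : ∀ x i j p q : M,
      T (T x i j) p q + T (T x i p) j q + T (T x j q) i p + T (T x p q) i j = 0)
    (hf₁ : ∀ x i j p q a : M,
      T (T (T x i q) j a) p a + T (T (T x i a) j q) p a + T (T (T x i a) j a) p q = 0)
    (hf₂ : ∀ x i j p q a : M,
      T (T (T x p i) j a) a q + T (T (T x p j) i a) a q
        + T (T (T x q i) j a) a p + T (T (T x q j) i a) a p = 0)
    (x b : M) (a : Fin 4 → M) (e : Equiv.Perm (Fin 4)) :
    wordSpan T x b (a ∘ e) ≤ wordSpan T x b a := by
  have he : e ∈ Submonoid.closure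
      (Set.range fun i : Fin 3 ↦ Equiv.swap i.castSucc i.succ) := by
    rw [Equiv.Perm.mclosure_swap_castSucc_succ]
    trivial
  induction he using Submonoid.closure_induction generalizing a with
  | one => exact le_rfl
  | mul f g _ _ hf hg => exact (hg (a ∘ f)).trans (hf a)
  | mem e he =>
    obtain ⟨h₀, h₁, h₂, h₃, h₄⟩ := wordSpan_le_iff.1 (le_refl (wordSpan T x b a))
    have hneg : ∀ {v : M}, v ∈ wordSpan T x b a → -v ∈ wordSpan T x b a := Submodule.neg_mem _
    have hswap := apply_apply_swap_of_eq hskew hX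
    have hA : T (T (T x (a 1) (a 3)) (a 0) b) (a 2) b ∈ wordSpan T x b a := by
      have h := hf₂ x (a 0) (a 1) (a 2) (a 3) b
      rw [hskew _ b, hskew _ b, hskew _ b, hskew _ b, hskew x (a 2), hskew x (a 2),
        hskew x (a 3), hskew x (a 3)] at h
      simp only [map_neg, LinearMap.neg_apply, neg_neg] at h
      rw [eq_neg_of_add_eq_zero_right h]
      exact hneg (add_mem (add_mem h₁ h₃) h₂)
    have hB : T (T (T x (a 1) b) (a 0) (a 2)) (a 3) b ∈ wordSpan T x b a := by
      have h := congrArg (fun v ↦ T v (a 3) b) (hX x (a 0) (a 2) b (a 1))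
      rw [hskew _ b (a 1), hskew _ b (a 1), hskew _ (a 2) (a 1), hskew _ (a 2) (a 1)] at h
      simp only [map_add, map_neg, map_zero, LinearMap.add_apply, LinearMap.neg_apply,
        LinearMap.zero_apply] at h
      have hrw : T (T (T x (a 1) b) (a 0) (a 2)) (a 3) b =
          -(T (T (T x (a 0) (a 2)) (a 1) b) (a 3) b + T (T (T x (a 0) b) (a 1) (a 2)) (a 3) b
            + T (T (T x (a 1) (a 2)) (a 0) b) (a 3) b) := by
        linear_combination (norm := module) -h
      rw [hrw]
      exact hneg (add_mem (add_mem h₁ h₄) h₃)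
    have hB' : T (T (T x (a 0) b) (a 1) (a 3)) (a 2) b ∈ wordSpan T x b a := by
      have h := hf₁ x (a 0) (a 1) (a 2) (a 3) b
      have h' := hf₁ x (a 0) (a 1) (a 3) (a 2) b
      rw [hskew _ (a 3) (a 2)] at h'
      have hrw : T (T (T x (a 0) b) (a 1) (a 3)) (a 2) b =
          -(T (T (T x (a 0) (a 3)) (a 1) b) (a 2) b + T (T (T x (a 0) (a 2)) (a 1) b) (a 3) b
            + T (T (T x (a 0) b) (a 1) (a 2)) (a 3) b) := by
        linear_combination (norm := module) h + h'
      rw [hrw]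
      exact hneg (add_mem (add_mem h₂ h₁) h₄)
    obtain ⟨i, rfl⟩ := he
    fin_cases i
    · refine wordSpan_le_iff.2 ⟨?_, h₃, hA, h₁, hB⟩
      change T (T (T x (a 1) (a 0)) (a 2) b) (a 3) b ∈ _
      rw [hskew x]
      simpa using h₀
    · refine wordSpan_le_iff.2 ⟨h₁, h₀, ?_, ?_, ?_⟩
      · change T (T (T x (a 0) (a 3)) (a 2) b) (a 1) b ∈ _
        rw [hswap]
        exact hneg h₂
      · change T (T (T x (a 2) (a 1)) (a 0) b) (a 3) b ∈ _
        rw [hskew x]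
        simpa using h₃
      · change T (T (T x (a 0) b) (a 2) (a 1)) (a 3) b ∈ _
        rw [hskew _ (a 2)]
        simpa using h₄
    · refine wordSpan_le_iff.2 ⟨?_, h₂, h₁, hA, hB'⟩
      change T (T (T x (a 0) (a 1)) (a 3) b) (a 2) b ∈ _
      rw [hswap]
      exact hneg h₀

/-- If the two letters `b` of a word stand in the places `r` and `r.succAbove t`, the word belongs
to any submodule containing the three standard words on the remaining letters in their order. -/
lemma word_mem (halt : ∀ x y z : M, x = y ∨ y = z ∨ x = z → T x y z = 0)
    {N : Submodule (ZMod 3) M} {x b : M} {u : Fin 4 → M} {v : Fin 6 → M} {r : Fin 6} {t : Fin 5}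
    (hr : v r = b) (ht : v (r.succAbove t) = b)
    (hu : ∀ i, v (r.succAbove (t.succAbove i)) = u i)
    (hA : T (T (T x (u 0) (u 1)) (u 2) b) (u 3) b ∈ N)
    (hB : T (T (T x (u 0) b) (u 1) (u 2)) (u 3) b ∈ N)
    (hC : T (T (T x (u 0) b) (u 1) b) (u 2) (u 3) ∈ N) :
    T (T (T x (v 0) (v 1)) (v 2) (v 3)) (v 4) (v 5) ∈ N := by
  have hb (y : M) : T y b b = 0 := halt y b b (by simp)
  have hskew (y z : M) : T y b z = -T y z b := apply_swap_right halt y b z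
  have h0 := hu 0
  have h1 := hu 1
  have h2 := hu 2
  have h3 := hu 3
  fin_cases r <;> fin_cases t <;>
    simp [Fin.succAbove, Fin.lt_def] at hr ht h0 h1 h2 h3 <;>
    simp [*]

/-- The letters of a rearrangement of `a₁, …, a₄, b, b` other than the two letters `b`. -/
lemma exists_perm_of_removeNth {α : Type*} (σ : Equiv.Perm (Fin 6)) (a₁ a₂ a₃ a₄ b : α)
    {r : Fin 6} {t : Fin 5}
    (hr : σ r = 4) (ht : σ (r.succAbove t) = 5) :
    ∃ e : Equiv.Perm (Fin 4), ∀ i,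
      ![a₁, a₂, a₃, a₄, b, b] (σ (r.succAbove (t.succAbove i))) = ![a₁, a₂, a₃, a₄] (e i) := by
  have hlt (i : Fin 4) : ∃ k : Fin 4, σ (r.succAbove (t.succAbove i)) = k.castAdd 2 := by
    have h4 : σ (r.succAbove (t.succAbove i)) ≠ 4 := by
      rw [← hr, σ.injective.ne_iff]
      exact Fin.succAbove_ne _ _
    have h5 : σ (r.succAbove (t.succAbove i)) ≠ 5 := by
      rw [← ht, σ.injective.ne_iff, Fin.succAbove_right_injective.ne_iff]
      exact Fin.succAbove_ne _ _
    generalize σ (r.succAbove (t.succAbove i)) = k at h4 h5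
    revert k
    decide
  choose g hg using hlt
  have hinj : Function.Injective g := fun i j hij ↦
    Fin.succAbove_right_injective <| Fin.succAbove_right_injective <| σ.injective <| by
      rw [hg, hg, hij]
  refine ⟨Equiv.ofBijective g (Finite.injective_iff_bijective.1 hinj), fun i ↦ ?_⟩
  rw [hg, Equiv.ofBijective_apply]
  generalize g i = k
  fin_cases k <;> rfl

end TernaryWords

open TernaryWords in
/-- Let `M` be a vector space over `𝔽₃` and `T` an alternating
trilinear map satisfying (X), (f₁) and (f₂).  Then, with
`(w₁,…,w₆) = (a₁,a₂,a₃,a₄,b,b)`, every permuted word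
`T (T (T x w_{σ1} w_{σ2}) w_{σ3} w_{σ4}) w_{σ5} w_{σ6}` lies in the span of the
five listed elements. -/
theorem stmt_17 (M : Type*) [AddCommGroup M] [Module (ZMod 3) M]
    (T : M →ₗ[ZMod 3] M →ₗ[ZMod 3] M →ₗ[ZMod 3] M)
    (halt : ∀ x y z : M, x = y ∨ y = z ∨ x = z → T x y z = 0)
    (hX : ∀ x i j p q : M,
      T (T x i j) p q + T (T x i p) j q + T (T x j q) i p + T (T x p q) i j = 0)
    (hf₁ : ∀ x i j p q a : M,
      T (T (T x i q) j a) p a + T (T (T x i a) j q) p a + T (T (T x i a) j a) p q = 0)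
    (hf₂ : ∀ x i j p q a : M,
      T (T (T x p i) j a) a q + T (T (T x p j) i a) a q
        + T (T (T x q i) j a) a p + T (T (T x q j) i a) a p = 0)
    (x a₁ a₂ a₃ a₄ b : M) (σ : Equiv.Perm (Fin 6)) :
    T (T (T x (![a₁, a₂, a₃, a₄, b, b] (σ 0)) (![a₁, a₂, a₃, a₄, b, b] (σ 1)))
          (![a₁, a₂, a₃, a₄, b, b] (σ 2)) (![a₁, a₂, a₃, a₄, b, b] (σ 3)))
        (![a₁, a₂, a₃, a₄, b, b] (σ 4)) (![a₁, a₂, a₃, a₄, b, b] (σ 5)) ∈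
      Submodule.span (ZMod 3)
        ({T (T (T x a₁ a₂) a₃ b) a₄ b, T (T (T x a₁ a₃) a₂ b) a₄ b,
          T (T (T x a₁ a₄) a₂ b) a₃ b, T (T (T x a₂ a₃) a₁ b) a₄ b,
          T (T (T x a₁ b) a₂ a₃) a₄ b} : Set M) := by
  have hskew := apply_swap_right halt
  obtain ⟨t, ht⟩ := Fin.exists_succAbove_eq (x := σ.symm 5) (y := σ.symm 4)
    (σ.symm.injective.ne (by decide))
  have hr : σ (σ.symm 4) = 4 := σ.apply_symm_apply 4
  have ht : σ ((σ.symm 4).succAbove t) = 5 := by rw [ht, σ.apply_symm_apply]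
  obtain ⟨e, he⟩ := exists_perm_of_removeNth σ a₁ a₂ a₃ a₄ b hr ht
  refine wordSpan_comp_perm_le hskew hX hf₁ hf₂ x b ![a₁, a₂, a₃, a₄] e ?_
  generalize hu : ![a₁, a₂, a₃, a₄] ∘ e = u
  obtain ⟨h₀, h₁, -, -, h₄⟩ := wordSpan_le_iff.1 (le_refl (wordSpan T x b u))
  refine word_mem halt (v := ![a₁, a₂, a₃, a₄, b, b] ∘ σ) (b := b) (u := u) (r := σ.symm 4)
    (t := t) ?_ ?_ ?_ h₀ h₄ ?_
  · rw [Function.comp_apply, hr]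
    rfl
  · rw [Function.comp_apply, ht]
    rfl
  · simpa [← hu] using he
  · have h := hf₁ x (u 0) (u 1) (u 3) (u 2) b
    rw [hskew _ (u 3) (u 2), ← sub_eq_add_neg, sub_eq_zero] at h
    exact h ▸ add_mem h₁ h₄
end

section
/- Let M and T be as in the context, and assume T satisfies, for all values of the arguments in M: (X) T(T(x,i,j),p,q) + T(T(x,i,p),j,q) + T(T(x,j,q),i,p) + T(T(x,p,q),i,j) = 0; (g₁) T(T(T(x,i,q),j,a),p,b) + T(T(T(x,i,q),j,b),p,a) + T(T(T(x,i,a),j,q),p,b) + T(T(T(x,i,b),j,q),p,a) + T(T(T(x,i,a),j,b),p,q) + T(T(T(x,i,b),j,a),p,q) = 0; and (g₂) T(T(T(x,p,i),j,a),b,q) + T(T(T(x,p,i),j,b),a,q) + T(T(T(x,p,j),i,a),b,q) + T(T(T(x,p,j),i,b),a,q) + T(T(T(x,q,i),j,a),b,p) + T(T(T(x,q,i),j,b),a,p) + T(T(T(x,q,j),i,a),b,p) + T(T(T(x,q,j),i,b),a,p) = 0. For x, a₁, …, a₆ ∈ M write W(i₁i₂.i₃i₄.i₅i₆) = T(T(T(x,a_{i₁},a_{i₂}),a_{i₃},a_{i₄}),a_{i₅},a_{i₆}).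 Then for every permutation σ of {1,…,6}, the element T(T(T(x,a_{σ(1)},a_{σ(2)}),a_{σ(3)},a_{σ(4)}),a_{σ(5)},a_{σ(6)}) lies in the 𝔽₃-linear span of the twenty elements W(12.34.56), W(13.24.56), W(23.14.56), W(14.23.56), W(12.35.46), W(13.25.46), W(23.15.46), W(15.23.46), W(12.45.36), W(14.25.36), W(24.15.36), W(13.45.26), W(34.15.26), W(23.45.16), W(12.36.45), W(13.26.45), W(23.16.45), W(16.23.45), W(14.26.35), W(15.26.34). -/
/-- The word `((i, j), (k, l), (m, n))` stands for the product
`T (T (T x aᵢ aⱼ) aₖ aₗ) aₘ aₙ`. -/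
abbrev Word := (ℕ × ℕ) × (ℕ × ℕ) × (ℕ × ℕ)

namespace Word

/-- Increasing rearrangement of a pair. -/
def sortPair (p : ℕ × ℕ) : ℕ × ℕ := if p.1 ≤ p.2 then p else p.swap

/-- Increasing rearrangement of each of the three pairs of a word. -/
def normalize (w : Word) : Word := (sortPair w.1, sortPair w.2.1, sortPair w.2.2)

section Eval

variable {R M : Type*} [CommRing R] [AddCommGroup M] [Module R M]
  (T : M →ₗ[R] M →ₗ[R] M →ₗ[R] M) (x : M) (a : ℕ → M)

/-- The value of a word. -/
def eval (w : Word) : M :=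
  T (T (T x (a w.1.1) (a w.1.2)) (a w.2.1.1) (a w.2.1.2)) (a w.2.2.1) (a w.2.2.2)

variable {T}

theorem apply_sortPair (hskew : ∀ u v w : M, T u v w = -T u w v) (u : M) (p : ℕ × ℕ) :
    T u (a (sortPair p).1) (a (sortPair p).2) = T u (a p.1) (a p.2) ∨
      T u (a (sortPair p).1) (a (sortPair p).2) = -T u (a p.1) (a p.2) := by
  unfold sortPair
  split_ifs
  · exact Or.inl rfl
  · exact Or.inr (hskew _ _ _)

theorem eval_normalize (hskew : ∀ u v w : M, T u v w = -T u w v) (w : Word) :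
    eval T x a w.normalize = eval T x a w ∨ eval T x a w.normalize = -eval T x a w := by
  unfold eval normalize
  rcases apply_sortPair a hskew x w.1 with h₁ | h₁ <;>
  rcases apply_sortPair a hskew (T x (a w.1.1) (a w.1.2)) w.2.1 with h₂ | h₂ <;>
  rcases apply_sortPair a hskew
    (T (T x (a w.1.1) (a w.1.2)) (a w.2.1.1) (a w.2.1.2)) w.2.2 with h₃ | h₃ <;>
  simp [h₁, h₂, h₃]

theorem eval_normalize_mem_iff (hskew : ∀ u v w : M, T u v w = -T u w v)
    (S : Submodule R M) (w : Word) : eval T x a w.normalize ∈ S ↔ eval T x a w ∈ S := by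
  rcases eval_normalize x a hskew w with h | h <;> simp [h]

end Eval

/-- Linear relations between words: `inner` and `outer` are the two ways of extending the
identity (X) to words of length three, `cubic` is (g₁) and `mixed` is (g₂). -/
inductive Relation
  | inner (i j p q a b : ℕ)
  | outer (i j p q a b : ℕ)
  | cubic (i j p q a b : ℕ)
  | mixed (i j p q a b : ℕ)

/-- The words whose values add up to zero by a given relation. -/
def Relation.words : Relation → List Word
  | inner i j p q a b =>
    [((i, j), (p, q), (a, b)), ((i, p), (j, q), (a, b)),
      ((j, q), (i, p), (a, b)), ((p, q), (i, j), (a, b))]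
  | outer i j p q a b =>
    [((a, b), (i, j), (p, q)), ((a, b), (i, p), (j, q)),
      ((a, b), (j, q), (i, p)), ((a, b), (p, q), (i, j))]
  | cubic i j p q a b =>
    [((i, q), (j, a), (p, b)), ((i, q), (j, b), (p, a)), ((i, a), (j, q), (p, b)),
      ((i, b), (j, q), (p, a)), ((i, a), (j, b), (p, q)), ((i, b), (j, a), (p, q))]
  | mixed i j p q a b =>
    [((p, i), (j, a), (b, q)), ((p, i), (j, b), (a, q)),
      ((p, j), (i, a), (b, q)), ((p, j), (i, b), (a, q)),
      ((q, i), (j, a), (b, p)), ((q, i), (j, b), (a, p)),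
      ((q, j), (i, a), (b, p)), ((q, j), (i, b), (a, p))]

/-- Extend a list of normalized words by the first word of a relation, provided that all other
words of the relation are already in the list. -/
def extend (K : List Word) (r : Relation) : List Word :=
  match r.words with
  | [] => K
  | w :: ws => if ∀ v ∈ ws, v.normalize ∈ K then w.normalize :: K else K

theorem eval_mem_of_mem_foldl_extend {R M : Type*} [CommRing R] [AddCommGroup M] [Module R M]
    {T : M →ₗ[R] M →ₗ[R] M →ₗ[R] M} {x : M} {a : ℕ → M}
    (hskew : ∀ u v w : M, T u v w = -T u w v)
    (hrel : ∀ r : Relation, (r.words.map (eval T x a)).sum = 0)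
    (S : Submodule R M) (rs : List Relation) (K : List Word)
    (hK : ∀ w ∈ K, eval T x a w ∈ S) :
    ∀ w ∈ rs.foldl extend K, eval T x a w ∈ S := by
  induction rs generalizing K with
  | nil => exact hK
  | cons r rs ih =>
    refine ih (extend K r) ?_
    have hr := hrel r
    unfold extend
    split
    · exact hK
    · rename_i w ws hw
      split_ifs with hws
      · refine List.forall_mem_cons.2 ⟨?_, hK⟩
        rw [eval_normalize_mem_iff x a hskew]
        rw [hw, List.map_cons, List.sum_cons] at hr
        rw [eq_neg_of_add_eq_zero_left hr]
        refine S.neg_mem (list_sum_mem ?_)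
        simp only [List.mem_map, forall_exists_index, and_imp, forall_apply_eq_imp_iff₂]
        exact fun v hv => (eval_normalize_mem_iff x a hskew S v).1 (hK _ (hws v hv))
      · exact hK

/-- The regular words. -/
def regular : List Word :=
  [((0, 1), (2, 3), (4, 5)), ((0, 2), (1, 3), (4, 5)), ((1, 2), (0, 3), (4, 5)),
    ((0, 3), (1, 2), (4, 5)), ((0, 1), (2, 4), (3, 5)), ((0, 2), (1, 4), (3, 5)),
    ((1, 2), (0, 4), (3, 5)), ((0, 4), (1, 2), (3, 5)), ((0, 1), (3, 4), (2, 5)),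
    ((0, 3), (1, 4), (2, 5)), ((1, 3), (0, 4), (2, 5)), ((0, 2), (3, 4), (1, 5)),
    ((2, 3), (0, 4), (1, 5)), ((1, 2), (3, 4), (0, 5)), ((0, 1), (2, 5), (3, 4)),
    ((0, 2), (1, 5), (3, 4)), ((1, 2), (0, 5), (3, 4)), ((0, 5), (1, 2), (3, 4)),
    ((0, 3), (1, 5), (2, 4)), ((0, 4), (1, 5), (2, 3))]

/-- Relations which, used in this order, express every multilinear word through regular ones. -/
def derivation : List Relation :=
  [.inner 1 3 2 0 4 5, .inner 1 4 2 0 3 5, .inner 1 5 2 0 3 4, .inner 2 3 0 1 4 5,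
    .inner 2 4 0 1 3 5, .inner 2 5 0 1 3 4, .outer 3 5 4 0 1 2, .outer 3 5 4 1 0 2,
    .outer 3 5 4 2 0 1, .outer 4 5 0 3 1 2, .outer 4 5 1 3 0 2, .outer 4 5 2 3 0 1,
    .cubic 0 1 3 5 4 2, .cubic 0 1 4 5 3 2, .cubic 0 1 5 4 3 2, .cubic 0 3 4 5 2 1,
    .cubic 0 3 5 4 2 1, .cubic 0 4 3 5 2 1, .cubic 0 4 5 3 2 1, .cubic 0 5 3 4 2 1,
    .cubic 0 5 4 3 2 1, .cubic 1 0 5 4 3 2, .cubic 1 3 5 4 2 0, .cubic 1 4 5 3 2 0,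
    .cubic 2 0 5 4 3 1, .cubic 2 3 5 4 1 0, .cubic 2 4 5 3 1 0, .mixed 1 0 3 2 5 4,
    .mixed 1 0 4 2 5 3, .mixed 1 0 5 3 4 2, .mixed 1 0 5 4 3 2, .mixed 2 0 3 1 5 4,
    .mixed 2 0 4 1 5 3, .mixed 2 0 5 3 4 1, .mixed 2 0 5 4 3 1, .mixed 3 1 2 0 5 4,
    .mixed 3 2 1 0 5 4, .mixed 4 1 2 0 5 3, .mixed 4 2 1 0 5 3, .inner 3 4 0 1 2 5,
    .inner 3 4 0 2 1 5, .inner 3 4 1 2 0 5, .inner 3 5 0 1 2 4, .inner 3 5 0 2 1 4,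
    .inner 4 5 0 1 2 3, .inner 4 5 0 2 1 3, .outer 3 4 1 2 0 5, .outer 3 5 0 1 2 4,
    .outer 3 5 0 2 1 4, .outer 3 5 1 2 0 4, .outer 4 5 0 1 2 3, .outer 4 5 0 2 1 3,
    .outer 4 5 1 2 0 3, .cubic 1 2 3 5 4 0, .cubic 1 2 4 5 3 0, .cubic 1 3 0 5 4 2,
    .cubic 2 1 3 5 4 0, .cubic 2 1 4 5 3 0, .cubic 2 3 0 5 4 1, .cubic 3 1 4 5 2 0,
    .cubic 4 1 3 5 2 0, .mixed 3 0 4 1 5 2, .mixed 3 0 5 1 4 2, .mixed 3 1 4 0 5 2,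
    .mixed 3 1 5 0 4 2, .mixed 3 2 4 0 5 1, .mixed 3 2 5 0 4 1, .mixed 4 0 5 1 3 2,
    .mixed 4 1 5 0 3 2, .mixed 4 2 5 0 3 1]

/-- The increasing pairs of indices below six. -/
def pairs : List (ℕ × ℕ) :=
  [(0, 1), (0, 2), (0, 3), (0, 4), (0, 5), (1, 2), (1, 3), (1, 4), (1, 5), (2, 3), (2, 4),
    (2, 5), (3, 4), (3, 5), (4, 5)]

/-- Two pairs have no entry in common. -/
def Apart (p q : ℕ × ℕ) : Prop := p.1 ≠ q.1 ∧ p.1 ≠ q.2 ∧ p.2 ≠ q.1 ∧ p.2 ≠ q.2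

instance (p q : ℕ × ℕ) : Decidable (Apart p q) := by unfold Apart; infer_instance

theorem Apart.sortPair {p q : ℕ × ℕ} (h : Apart p q) : Apart (sortPair p) (sortPair q) := by
  obtain ⟨h₁, h₂, h₃, h₄⟩ := h
  unfold Word.sortPair
  split_ifs
  exacts [⟨h₁, h₂, h₃, h₄⟩, ⟨h₂, h₁, h₄, h₃⟩, ⟨h₃, h₄, h₁, h₂⟩, ⟨h₄, h₃, h₂, h₁⟩]

theorem sortPair_mem_pairs : ∀ i j : Fin 6, i ≠ j → sortPair (i.val, j.val) ∈ pairs := by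
  decide

theorem mem_foldl_extend_regular :
    ∀ p ∈ pairs, ∀ q ∈ pairs, Apart p q → ∀ r ∈ pairs, Apart p r → Apart q r →
      (p, q, r) ∈ derivation.foldl extend regular := by
  decide +kernel

theorem normalize_mem_foldl_extend_regular (σ : Equiv.Perm (Fin 6)) :
    normalize ((σ 0, σ 1), (σ 2, σ 3), (σ 4, σ 5)) ∈ derivation.foldl extend regular := by
  have hσ {i j : Fin 6} (h : i ≠ j) : (σ i).val ≠ (σ j).val := by simpa [Fin.val_inj] using h
  refine mem_foldl_extend_regular _ (sortPair_mem_pairs _ _ ?_) _ (sortPair_mem_pairs _ _ ?_)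
    (Apart.sortPair ⟨?_, ?_, ?_, ?_⟩) _ (sortPair_mem_pairs _ _ ?_)
    (Apart.sortPair ⟨?_, ?_, ?_, ?_⟩) (Apart.sortPair ⟨?_, ?_, ?_, ?_⟩)
  all_goals first | exact hσ (by decide) | exact σ.injective.ne (by decide)

end Word

/-- Let `M` be a vector space over `𝔽₃` and `T` an alternating
trilinear map satisfying (X), (g₁) and (g₂).  Then every permuted word
`T (T (T x a_{σ1} a_{σ2}) a_{σ3} a_{σ4}) a_{σ5} a_{σ6}` lies in the span of the
twenty listed elements (the regular words of Lemma 6 of the paper). -/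
theorem stmt_18 (M : Type*) [AddCommGroup M] [Module (ZMod 3) M]
    (T : M →ₗ[ZMod 3] M →ₗ[ZMod 3] M →ₗ[ZMod 3] M)
    (halt : ∀ x y z : M, x = y ∨ y = z ∨ x = z → T x y z = 0)
    (hX : ∀ x i j p q : M,
      T (T x i j) p q + T (T x i p) j q + T (T x j q) i p + T (T x p q) i j = 0)
    (hg₁ : ∀ x i j p q a b : M,
      T (T (T x i q) j a) p b + T (T (T x i q) j b) p a
        + T (T (T x i a) j q) p b + T (T (T x i b) j q) p a
        + T (T (T x i a) j b) p q + T (T (T x i b) j a) p q = 0)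
    (hg₂ : ∀ x i j p q a b : M,
      T (T (T x p i) j a) b q + T (T (T x p i) j b) a q
        + T (T (T x p j) i a) b q + T (T (T x p j) i b) a q
        + T (T (T x q i) j a) b p + T (T (T x q i) j b) a p
        + T (T (T x q j) i a) b p + T (T (T x q j) i b) a p = 0)
    (x a₁ a₂ a₃ a₄ a₅ a₆ : M) (σ : Equiv.Perm (Fin 6)) :
    T (T (T x (![a₁, a₂, a₃, a₄, a₅, a₆] (σ 0)) (![a₁, a₂, a₃, a₄, a₅, a₆] (σ 1)))
          (![a₁, a₂, a₃, a₄, a₅, a₆] (σ 2)) (![a₁, a₂, a₃, a₄, a₅, a₆] (σ 3)))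
        (![a₁, a₂, a₃, a₄, a₅, a₆] (σ 4)) (![a₁, a₂, a₃, a₄, a₅, a₆] (σ 5)) ∈
      Submodule.span (ZMod 3)
        ({T (T (T x a₁ a₂) a₃ a₄) a₅ a₆, T (T (T x a₁ a₃) a₂ a₄) a₅ a₆,
          T (T (T x a₂ a₃) a₁ a₄) a₅ a₆, T (T (T x a₁ a₄) a₂ a₃) a₅ a₆,
          T (T (T x a₁ a₂) a₃ a₅) a₄ a₆, T (T (T x a₁ a₃) a₂ a₅) a₄ a₆,
          T (T (T x a₂ a₃) a₁ a₅) a₄ a₆, T (T (T x a₁ a₅) a₂ a₃) a₄ a₆,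
          T (T (T x a₁ a₂) a₄ a₅) a₃ a₆, T (T (T x a₁ a₄) a₂ a₅) a₃ a₆,
          T (T (T x a₂ a₄) a₁ a₅) a₃ a₆, T (T (T x a₁ a₃) a₄ a₅) a₂ a₆,
          T (T (T x a₃ a₄) a₁ a₅) a₂ a₆, T (T (T x a₂ a₃) a₄ a₅) a₁ a₆,
          T (T (T x a₁ a₂) a₃ a₆) a₄ a₅, T (T (T x a₁ a₃) a₂ a₆) a₄ a₅,
          T (T (T x a₂ a₃) a₁ a₆) a₄ a₅, T (T (T x a₁ a₆) a₂ a₃) a₄ a₅,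
          T (T (T x a₁ a₄) a₂ a₆) a₃ a₅, T (T (T x a₁ a₅) a₂ a₆) a₃ a₄} : Set M) := by
  have hskew : ∀ u v w : M, T u v w = -T u w v := by
    intro u v w
    have h := halt u (v + w) (v + w) (by simp)
    simp only [map_add, LinearMap.add_apply, halt u v v (by simp), halt u w w (by simp),
      zero_add, add_zero] at h
    exact eq_neg_of_add_eq_zero_right h
  let a : ℕ → M := fun n => [a₁, a₂, a₃, a₄, a₅, a₆].getD n 0
  have ha : ∀ i : Fin 6, ![a₁, a₂, a₃, a₄, a₅, a₆] i = a i := fun i => by fin_cases i <;> rfl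
  have hrel : ∀ r : Word.Relation, (r.words.map (Word.eval T x a)).sum = 0 := by
    rintro (⟨i, j, p, q, b, d⟩ | ⟨i, j, p, q, b, d⟩ | ⟨i, j, p, q, b, d⟩ | ⟨i, j, p, q, b, d⟩)
    · simpa [Word.Relation.words, Word.eval, add_assoc] using
        congrArg (T · (a b) (a d)) (hX x (a i) (a j) (a p) (a q))
    · simpa [Word.Relation.words, Word.eval, add_assoc] using
        hX (T x (a b) (a d)) (a i) (a j) (a p) (a q)
    · simpa [Word.Relation.words, Word.eval, add_assoc] using
        hg₁ x (a i) (a j) (a p) (a q) (a b) (a d)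
    · simpa [Word.Relation.words, Word.eval, add_assoc] using
        hg₂ x (a i) (a j) (a p) (a q) (a b) (a d)
  simp only [ha]
  refine (Word.eval_normalize_mem_iff x a hskew _
    ((σ 0, σ 1), (σ 2, σ 3), (σ 4, σ 5))).1 (Word.eval_mem_of_mem_foldl_extend hskew hrel _
      Word.derivation Word.regular ?_ _ (Word.normalize_mem_foldl_extend_regular σ))
  simp only [Word.regular, List.forall_mem_cons]
  refine ⟨?_, ?_, ?_, ?_, ?_, ?_, ?_, ?_, ?_, ?_, ?_, ?_, ?_, ?_, ?_, ?_, ?_, ?_, ?_, ?_, ?_⟩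
  on_goal 21 => simp
  all_goals
    refine Submodule.subset_span ?_
    simp only [Word.eval, a, List.getD_cons_zero, List.getD_cons_succ, Set.mem_insert_iff,
      Set.mem_singleton_iff, true_or, or_true]
end

section
/- Let M and T be as in the context, and assume T satisfies, for all values of the arguments in M: (X) T(T(x,i,j),p,q) + T(T(x,i,p),j,q) + T(T(x,j,q),i,p) + T(T(x,p,q),i,j) = 0; (f₁) T(T(T(x,i,q),j,a),p,a) + T(T(T(x,i,a),j,q),p,a) + T(T(T(x,i,a),j,a),p,q) = 0; (f₂) T(T(T(x,p,i),j,a),a,q) + T(T(T(x,p,j),i,a),a,q) + T(T(T(x,q,i),j,a),a,p) + T(T(T(x,q,j),i,a),a,p) = 0; (g₁) T(T(T(x,i,q),j,a),p,b) + T(T(T(x,i,q),j,b),p,a) + T(T(T(x,i,a),j,q),p,b) + T(T(T(x,i,b),j,q),p,a) + T(T(T(x,i,a),j,b),p,q) + T(T(T(x,i,b),j,a),p,q) = 0; (g₂) T(T(T(x,p,i),j,a),b,q) + T(T(T(x,p,i),j,b),a,q) + T(T(T(x,p,j),i,a),b,q) + T(T(T(x,p,j),i,b),a,q) + T(T(T(x,q,i),j,a),b,p)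 + T(T(T(x,q,i),j,b),a,p) + T(T(T(x,q,j),i,a),b,p) + T(T(T(x,q,j),i,b),a,p) = 0; (g₃) T(T(T(T(x,a₂,a₄),a₁,b),a₃,c),b,c) + T(T(T(T(x,a₂,a₃),a₁,b),a₄,c),b,c) + T(T(T(T(x,a₁,a₄),a₂,b),a₃,c),b,c) + T(T(T(T(x,a₁,a₃),a₂,b),a₄,c),b,c) = 0; (s₂) T(T(T(T(x,u,v),u,b),v,c),b,c) = 0; and (r) T(T(T(x,i,c),j,b),b,c) + T(T(T(x,i,b),j,c),b,c) = 0. Then for all x, a₁, a₂, a₃, a₄, b, c ∈ M, setting (w₁,…,w₈) = (a₁,a₂,a₃,a₄,b,b,c,c), for every permutation σ of {1,…,8} the element T(T(T(T(x,w_{σ(1)},w_{σ(2)}),w_{σ(3)},w_{σ(4)}),w_{σ(5)},w_{σ(6)}),w_{σ(7)},w_{σ(8)}) lies in the 𝔽₃-linear span of the seven elements v₁ = T(T(T(T(x,a₁,a₂),a₃,b),a₄,c),b,c), v₂ = T(T(T(T(x,a₁,a₃),a₂,b),a₄,c),b,c), v₃ = T(T(T(T(x,a₂,a₃),a₁,b),a₄,c),b,c),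 v₄ = T(T(T(T(x,a₁,a₄),a₂,b),a₃,c),b,c), v₅ = T(T(T(T(x,a₁,b),a₂,a₃),a₄,c),b,c), v₆ = T(T(T(T(x,a₁,c),a₂,a₃),a₄,b),b,c), v₇ = T(T(T(T(x,a₁,b),a₂,c),a₃,a₄),b,c). -/
/-- Identities satisfied by the words `W i₁ j₁ i₂ j₂ i₃ j₃ i₄ j₄`, the values at a fixed argument of
`T (T (T (T x i₁ j₁) i₂ j₂) i₃ j₃) i₄ j₄` under a linear map. -/
structure WordRelations {α N : Type*} [AddCommGroup N]
    (W : α → α → α → α → α → α → α → α → N) : Prop where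
  skew₁ (i j k l m n p q : α) : W j i k l m n p q = -W i j k l m n p q
  skew₂ (i j k l m n p q : α) : W i j l k m n p q = -W i j k l m n p q
  skew₃ (i j k l m n p q : α) : W i j k l n m p q = -W i j k l m n p q
  skew₄ (i j k l m n p q : α) : W i j k l m n q p = -W i j k l m n p q
  alt₁ (i k l m n p q : α) : W i i k l m n p q = 0
  alt₂ (i j k m n p q : α) : W i j k k m n p q = 0
  alt₃ (i j k l m p q : α) : W i j k l m m p q = 0
  alt₄ (i j k l m n p : α) : W i j k l m n p p = 0
  X₁ (i j p q k l m n : α) :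
    W i j p q k l m n + W i p j q k l m n + W j q i p k l m n + W p q i j k l m n = 0
  X₂ (k l i j p q m n : α) :
    W k l i j p q m n + W k l i p j q m n + W k l j q i p m n + W k l p q i j m n = 0
  X₃ (k l m n i j p q : α) :
    W k l m n i j p q + W k l m n i p j q + W k l m n j q i p + W k l m n p q i j = 0
  f₁ (i j p q a m n : α) :
    W i q j a p a m n + W i a j q p a m n + W i a j a p q m n = 0
  f₁' (m n i j p q a : α) :
    W m n i q j a p a + W m n i a j q p a + W m n i a j a p q = 0
  f₂ (m n i j p a : α) : W m n p i j a a p + W m n p j i a a p = 0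
  g₁ (i j p q a b m n : α) :
    W i q j a p b m n + W i q j b p a m n + W i a j q p b m n + W i b j q p a m n
      + W i a j b p q m n + W i b j a p q m n = 0
  g₂ (i j p q a b m n : α) :
    W p i j a b q m n + W p i j b a q m n + W p j i a b q m n + W p j i b a q m n
      + W q i j a b p m n + W q i j b a p m n + W q j i a b p m n + W q j i b a p m n = 0
  g₃ (a₁ a₂ a₃ a₄ b c : α) :
    W a₂ a₄ a₁ b a₃ c b c + W a₂ a₃ a₁ b a₄ c b c + W a₁ a₄ a₂ b a₃ c b c
      + W a₁ a₃ a₂ b a₄ c b c = 0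
  sq (i j k l b c : α) : W i j k l b c b c = 0
  r (i j b c m n : α) : W i c j b b c m n + W i b j c b c m n = 0
  r' (m n i j b c : α) : W m n i c j b b c + W m n i b j c b c = 0

/-- A property of quadruples of indices that is invariant under adjacent transpositions holds for
all arrangements of four indices as soon as it holds for one. -/
theorem forall_nodup_of_adjacent_swaps {P : Fin 4 → Fin 4 → Fin 4 → Fin 4 → Prop}
    (h₁ : ∀ i j k l, [i, j, k, l].Nodup → P i j k l → P j i k l)
    (h₂ : ∀ i j k l, [i, j, k, l].Nodup → P i j k l → P i k j l)
    (h₃ : ∀ i j k l, [i, j, k, l].Nodup → P i j k l → P i j l k)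
    (h : P 0 1 2 3) (i j k l : Fin 4) (hn : [i, j, k, l].Nodup) : P i j k l := by
  have key : ∀ τ : Equiv.Perm (Fin 4), P (τ 0) (τ 1) (τ 2) (τ 3) := by
    have nodup (τ : Equiv.Perm (Fin 4)) : [τ 0, τ 1, τ 2, τ 3].Nodup := by simp
    intro τ
    have hτ : τ ∈ Submonoid.closure
        (Set.range fun i : Fin 3 => Equiv.swap i.castSucc i.succ) := by
      rw [Equiv.Perm.mclosure_swap_castSucc_succ]; trivial
    induction hτ using Submonoid.closure_induction_right with
    | one => exact h
    | mul_right τ _ s hs ih =>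
      obtain ⟨m, rfl⟩ := hs
      fin_cases m
      · exact h₁ _ _ _ _ (nodup τ) ih
      · exact h₂ _ _ _ _ (nodup τ) ih
      · exact h₃ _ _ _ _ (nodup τ) ih
  have hinj : Function.Injective ![i, j, k, l] := by
    rw [← List.nodup_ofFn]; simpa using hn
  exact key (Equiv.ofBijective _ (Finite.injective_iff_bijective.1 hinj))

namespace WordRelations

variable {α N : Type*} [AddCommGroup N] {W : α → α → α → α → α → α → α → α → N}

theorem flip₁ (hW : WordRelations W) {i j k l m n p q : α} (h : W i j k l m n p q = 0) :
    W j i k l m n p q = 0 := by rw [hW.skew₁, h, neg_zero]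

theorem flip₂ (hW : WordRelations W) {i j k l m n p q : α} (h : W i j k l m n p q = 0) :
    W i j l k m n p q = 0 := by rw [hW.skew₂, h, neg_zero]

theorem flip₃ (hW : WordRelations W) {i j k l m n p q : α} (h : W i j k l m n p q = 0) :
    W i j k l n m p q = 0 := by rw [hW.skew₃, h, neg_zero]

theorem flip₄ (hW : WordRelations W) {i j k l m n p q : α} (h : W i j k l m n p q = 0) :
    W i j k l m n q p = 0 := by rw [hW.skew₄, h, neg_zero]

theorem bc_ac₁ (hW : WordRelations W) {a b c k l m n : α} (h : W a c b c k l m n = 0) :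
    W b c a c k l m n = 0 := by
  simpa [hW.alt₁, hW.alt₂, hW.alt₃, hW.alt₄, h] using hW.X₁ a b c c k l m n

theorem bc_ab₁ (hW : WordRelations W) {a b c k l m n : α} (h : W a b b c k l m n = 0) :
    W b c a b k l m n = 0 := by
  exact hW.flip₁ (hW.bc_ac₁ (hW.flip₂ h))

theorem bc_ac₂ (hW : WordRelations W) {a b c k l m n : α} (h : W k l a c b c m n = 0) :
    W k l b c a c m n = 0 := by
  simpa [hW.alt₁, hW.alt₂, hW.alt₃, hW.alt₄, h] using hW.X₂ k l a b c c m n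

theorem bc_ab₂ (hW : WordRelations W) {a b c k l m n : α} (h : W k l a b b c m n = 0) :
    W k l b c a b m n = 0 := by
  exact hW.flip₂ (hW.bc_ac₂ (hW.flip₃ h))

theorem bc_ac₃ (hW : WordRelations W) {a b c k l m n : α} (h : W k l m n a c b c = 0) :
    W k l m n b c a c = 0 := by
  simpa [hW.alt₁, hW.alt₂, hW.alt₃, hW.alt₄, h] using hW.X₃ k l m n a b c c

theorem bc_ab₃ (hW : WordRelations W) {a b c k l m n : α} (h : W k l m n a b b c = 0) :
    W k l m n b c a b = 0 := by
  exact hW.flip₃ (hW.bc_ac₃ (hW.flip₄ h))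

/-- Words of shape `aa ab ac bc`. -/
theorem aa_ab_ac_bc (hW : WordRelations W) (e : Fin 4 → α) (b c : α)
    (h₁ : W (e 0) (e 1) (e 2) b (e 3) c b c = 0) (h₂ : W (e 0) (e 2) (e 1) b (e 3) c b c = 0)
    (h₃ : W (e 1) (e 2) (e 0) b (e 3) c b c = 0) (h₄ : W (e 0) (e 3) (e 1) b (e 2) c b c = 0)
    (i j k l : Fin 4) (hn : [i, j, k, l].Nodup) :
    W (e i) (e j) (e k) b (e l) c b c = 0 := by
  have swap_last (i j k l : α) (h : W i j k b l c b c = 0) : W i j l b k c b c = 0 := by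
    have hr := hW.r' i j k l b c
    have hf := hW.f₂ i j k l c b
    rw [h, add_zero] at hr
    rw [hW.flip₂ hr, zero_add] at hf
    simpa [hW.skew₂ _ _ c, hf] using hW.r' i j l k b c
  have h₅ : W (e 1) (e 3) (e 0) b (e 2) c b c = 0 := by
    simpa [h₂, h₃, h₄] using hW.g₃ (e 0) (e 1) (e 2) (e 3) b c
  have h₆ : W (e 2) (e 3) (e 0) b (e 1) c b c = 0 := by
    simpa [h₁, hW.flip₁ h₃, swap_last _ _ _ _ h₄] using hW.g₃ (e 0) (e 2) (e 1) (e 3) b c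
  have flip_first (i j k l : α) (h : W i j k b l c b c = 0) := hW.flip₁ h
  fin_cases i <;> fin_cases j <;> fin_cases k <;> fin_cases l <;>
    first
    | (exfalso; revert hn; decide)
    | (simp only [Fin.mk_zero, Fin.mk_one, Fin.reduceFinMk]
       first
       | assumption
       | exact flip_first _ _ _ _ (by assumption)
       | exact swap_last _ _ _ _ (by assumption)
       | exact flip_first _ _ _ _ (swap_last _ _ _ _ (by assumption)))

/-- Words of shape `ab aa ac bc`, modulo those of shape `aa ab ac bc`. -/
theorem ab_aa_ac_bc (hW : WordRelations W) (e : Fin 4 → α) (b c : α)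
    (hY : ∀ i j k l : Fin 4, [i, j, k, l].Nodup → W (e i) (e j) (e k) b (e l) c b c = 0)
    (h : W (e 0) b (e 1) (e 2) (e 3) c b c = 0)
    (i j k l : Fin 4) (hn : [i, j, k, l].Nodup) :
    W (e i) b (e j) (e k) (e l) c b c = 0 := by
  refine forall_nodup_of_adjacent_swaps
    (P := fun i j k l => W (e i) b (e j) (e k) (e l) c b c = 0) ?_ ?_ ?_ h i j k l hn
  · intro i j k l hn h
    exact hW.flip₂ (by
      simpa [hY k i j l (by grind), hY k j i l (by grind), hW.flip₂ h]
        using hW.X₁ (e k) (e i) (e j) b (e l) c b c)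
  · intro i j k l _ h
    exact hW.flip₂ h
  · intro i j k l hn h
    simpa [hW.flip₃ h, hW.sq, hW.flip₃ (hY i k j l (by grind)), hW.flip₃ (hY i l j k (by grind)),
      hW.skew₃ _ _ _ _ (e k) c, hW.skew₃ _ _ _ _ b c]
      using hW.g₁ (e i) (e j) c b (e k) (e l) b c

/-- Words of shape `ab ac aa bc`, modulo those of shape `aa ab ac bc` and `ab aa ac bc`. -/
theorem ab_ac_aa_bc (hW : WordRelations W) (e : Fin 4 → α) (b c : α)
    (hY : ∀ i j k l : Fin 4, [i, j, k, l].Nodup → W (e i) (e j) (e k) c (e l) b b c = 0)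
    (hYbc : ∀ i j k l : Fin 4, [i, j, k, l].Nodup → W (e i) (e j) b c (e k) (e l) b c = 0)
    (hZ : ∀ i j k l : Fin 4, [i, j, k, l].Nodup → W (e i) b (e j) (e k) (e l) c b c = 0)
    (h : W (e 0) b (e 1) c (e 2) (e 3) b c = 0)
    (i j k l : Fin 4) (hn : [i, j, k, l].Nodup) :
    W (e i) b (e j) c (e k) (e l) b c = 0 := by
  refine forall_nodup_of_adjacent_swaps
    (P := fun i j k l => W (e i) b (e j) c (e k) (e l) b c = 0) ?_ ?_ ?_ h i j k l hn
  · intro i j k l hn h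
    simpa [hW.sq, hW.skew₃ _ _ _ _ b c, hW.skew₃ _ _ _ _ _ c, hW.skew₁ _ b, h,
      hY l i j k (by grind), hY l j i k (by grind), hZ i j k l (by grind), hZ j i k l (by grind)]
      using hW.g₂ (e i) (e j) (e l) b (e k) c b c
  · intro i j k l hn h
    simpa [hW.flip₂ (hW.flip₃ h), hW.skew₂ _ _ _ c, hW.skew₂ _ _ b c,
      hYbc i j l k (by grind), hYbc i k l j (by grind), hY i j k l (by grind),
      hY i k j l (by grind), hW.skew₃ _ _ _ _ (e j) (e l)]
      using hW.g₁ (e i) c (e l) b (e j) (e k) b c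
  · intro i j k l _ h
    exact hW.flip₃ h

/-- The letters of a word: `inl i` stands for `e i`, `inr false` for `b` and `inr true` for `c`. -/
abbrev letter (e : Fin 4 → α) (b c : α) : Fin 4 ⊕ Bool → α :=
  Sum.elim e fun s => cond s c b

/-- The pairs of letters, up to order, other than the repeated letters `bb` and `cc`. -/
inductive PairShape
  | aa (i j : Fin 4)
  | ab (i : Fin 4)
  | ac (i : Fin 4)
  | bc

/-- The first letter of a pair. -/
abbrev PairShape.fst : PairShape → Fin 4 ⊕ Bool
  | aa i _ | ab i | ac i => .inl i
  | bc => .inr false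

/-- The second letter of a pair. -/
abbrev PairShape.snd : PairShape → Fin 4 ⊕ Bool
  | aa _ j => .inl j
  | ab _ => .inr false
  | ac _ | bc => .inr true

theorem forall_pair {P : Fin 4 ⊕ Bool → Fin 4 ⊕ Bool → Prop} (self : ∀ u, P u u)
    (symm : ∀ u v, P u v → P v u) (shape : ∀ s : PairShape, P s.fst s.snd) (u v) : P u v := by
  rcases u with i | _ | _ <;> rcases v with j | _ | _
  · exact shape (.aa i j)
  · exact shape (.ab i)
  · exact shape (.ac i)
  · exact symm _ _ (shape (.ab j))
  · exact self _
  · exact shape .bc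
  · exact symm _ _ (shape (.ac j))
  · exact symm _ _ (shape .bc)
  · exact self _

set_option maxHeartbeats 1000000 in
/-- If seven basic words vanish, then so do all words in the letters `a a a a b b c c`. -/
theorem eq_zero_of_perm (hW : WordRelations W) (e : Fin 4 → α) (b c : α)
    (h₁ : W (e 0) (e 1) (e 2) b (e 3) c b c = 0) (h₂ : W (e 0) (e 2) (e 1) b (e 3) c b c = 0)
    (h₃ : W (e 1) (e 2) (e 0) b (e 3) c b c = 0) (h₄ : W (e 0) (e 3) (e 1) b (e 2) c b c = 0)
    (h₅ : W (e 0) b (e 1) (e 2) (e 3) c b c = 0) (h₆ : W (e 0) c (e 1) (e 2) (e 3) b b c = 0)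
    (h₇ : W (e 0) b (e 1) c (e 2) (e 3) b c = 0) (l₁ l₂ l₃ l₄ l₅ l₆ l₇ l₈ : Fin 4 ⊕ Bool)
    (hl : [l₁, l₂, l₃, l₄, l₅, l₆, l₇, l₈].Perm [.inl 0, .inl 1, .inl 2, .inl 3,
      .inr false, .inr false, .inr true, .inr true]) :
    W (letter e b c l₁) (letter e b c l₂) (letter e b c l₃) (letter e b c l₄)
      (letter e b c l₅) (letter e b c l₆) (letter e b c l₇) (letter e b c l₈) = 0 := by
  have aa_ab_ac_bc := hW.aa_ab_ac_bc e b c h₁ h₂ h₃ h₄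
  have ab_aa_ac_bc := hW.ab_aa_ac_bc e b c aa_ab_ac_bc h₅
  have aa_ac_ab_bc (i j k l : Fin 4) (hn : [i, j, k, l].Nodup) :
      W (e i) (e j) (e k) c (e l) b b c = 0 := by
    simpa [aa_ab_ac_bc i j k l hn]
      using hW.r' (e i) (e j) (e k) (e l) b c
  have ac_aa_ab_bc (i j k l : Fin 4) (hn : [i, j, k, l].Nodup) :
      W (e i) c (e j) (e k) (e l) b b c = 0 :=
    hW.flip₄ (hW.ab_aa_ac_bc e c b (fun i j k l hn => hW.flip₄ (aa_ac_ab_bc i j k l hn))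
      (hW.flip₄ h₆) i j k l hn)
  have aa_ac_bc_ab (i j k l : Fin 4) (hn : [i, j, k, l].Nodup) :
      W (e i) (e j) (e k) c b c (e l) b = 0 :=
    hW.bc_ab₃ (aa_ac_ab_bc i j k l hn)
  have aa_bc_ac_ab (i j k l : Fin 4) (hn : [i, j, k, l].Nodup) :
      W (e i) (e j) b c (e k) c (e l) b = 0 :=
    hW.bc_ac₂ (aa_ac_bc_ab i j k l hn)
  have aa_bc_aa_bc (i j k l : Fin 4) (hn : [i, j, k, l].Nodup) :
      W (e i) (e j) b c (e k) (e l) b c = 0 := by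
    simpa [hW.flip₂ (aa_ab_ac_bc i j l k (by grind)),
      hW.flip₄ (aa_bc_ac_ab i j k l hn)]
      using hW.f₁' (e i) (e j) b (e k) b (e l) c
  have ab_ac_aa_bc := hW.ab_ac_aa_bc e b c aa_ac_ab_bc aa_bc_aa_bc ab_aa_ac_bc h₇
  have aa_ab_bc_ac (i j k l : Fin 4) (hn : [i, j, k, l].Nodup) :
      W (e i) (e j) (e k) b b c (e l) c = 0 :=
    hW.bc_ac₃ (aa_ab_ac_bc i j k l hn)
  have ab_aa_bc_ac (i j k l : Fin 4) (hn : [i, j, k, l].Nodup) :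
      W (e i) b (e j) (e k) b c (e l) c = 0 :=
    hW.bc_ac₃ (ab_aa_ac_bc i j k l hn)
  have aa_bc_ab_ac (i j k l : Fin 4) (hn : [i, j, k, l].Nodup) :
      W (e i) (e j) b c (e k) b (e l) c = 0 :=
    hW.bc_ab₂ (aa_ab_bc_ac i j k l hn)
  have ac_aa_bc_ab (i j k l : Fin 4) (hn : [i, j, k, l].Nodup) :
      W (e i) c (e j) (e k) b c (e l) b = 0 :=
    hW.bc_ab₃ (ac_aa_ab_bc i j k l hn)
  have ab_ac_ac_ab (i j k l : Fin 4) (hn : [i, j, k, l].Nodup) :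
      W (e i) b (e j) c (e k) c (e l) b = 0 :=
    hW.flip₄ (by
      simpa [ab_aa_ac_bc i j l k (by grind),
        ab_ac_aa_bc i j k l hn]
        using hW.f₁' (e i) b (e j) (e k) b (e l) c)
  have ac_ac_ab_ab (i j k l : Fin 4) (hn : [i, j, k, l].Nodup) :
      W (e i) c (e j) c (e k) b (e l) b = 0 :=
    hW.flip₃ (by
      simpa [aa_ac_bc_ab i k j l (by grind),
        ac_aa_bc_ab i j k l hn]
        using hW.f₁ (e i) (e j) b (e k) c (e l) b)
  have ac_ab_ac_ab (i j k l : Fin 4) (hn : [i, j, k, l].Nodup) :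
      W (e i) c (e j) b (e k) c (e l) b = 0 := by
    simpa [ab_ac_ac_ab i j k l hn,
      ac_ac_ab_ab i j k l hn]
      using hW.f₁ (e i) (e j) (e k) b c (e l) b
  have ac_bc_aa_ab (i j k l : Fin 4) (hn : [i, j, k, l].Nodup) :
      W (e i) c b c (e j) (e k) (e l) b = 0 := by
    simpa [ac_aa_bc_ab i j k l hn,
      ac_ab_ac_ab i j k l hn,
      ac_ac_ab_ab i k j l (by grind)]
      using hW.X₂ (e i) c (e j) (e k) b c (e l) b
  have bc_aa_ac_ab (i j k l : Fin 4) (hn : [i, j, k, l].Nodup) :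
      W b c (e i) (e j) (e k) c (e l) b = 0 := by
    simpa [aa_bc_ac_ab i j k l hn,
      ab_ac_ac_ab i j k l hn,
      ac_ab_ac_ab j i k l (by grind)]
      using hW.X₁ (e i) (e j) b c (e k) c (e l) b
  have bc_ac_aa_ab (i j k l : Fin 4) (hn : [i, j, k, l].Nodup) :
      W b c (e i) c (e j) (e k) (e l) b = 0 :=
    hW.bc_ac₁ (ac_bc_aa_ab i j k l hn)
  have ac_ab_ab_ac (i j k l : Fin 4) (hn : [i, j, k, l].Nodup) :
      W (e i) c (e j) b (e k) b (e l) c = 0 := by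
    simpa [ac_ac_ab_ab i j k l hn,
      ac_ab_ac_ab i j k l hn]
      using hW.f₁' (e i) c (e j) (e k) (e l) c b
  have aa_aa_bc_bc (i j k l : Fin 4) (hn : [i, j, k, l].Nodup) :
      W (e i) (e j) (e k) (e l) b c b c = 0 := by
    simpa [hW.flip₃ (aa_ac_ab_bc i j k l hn),
      hW.flip₄ (aa_ac_bc_ab i j k l hn)]
      using hW.f₁' (e i) (e j) (e k) b b (e l) c
  have aa_bc_bc_aa (i j k l : Fin 4) (hn : [i, j, k, l].Nodup) :
      W (e i) (e j) b c b c (e k) (e l) = 0 := by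
    simpa [hW.flip₂ (aa_ab_bc_ac i j l k (by grind)),
      hW.flip₃ (aa_bc_ab_ac i j l k (by grind))]
      using hW.f₁' (e i) (e j) b b (e k) (e l) c
  have ab_ab_ac_ac (i j k l : Fin 4) (hn : [i, j, k, l].Nodup) :
      W (e i) b (e j) b (e k) c (e l) c = 0 :=
    hW.flip₃ (by
      simpa [hW.flip₃ (aa_ab_bc_ac i k j l (by grind)),
        hW.flip₃ (ab_aa_bc_ac i j k l hn)]
        using hW.f₁ (e i) (e j) c (e k) b (e l) c)
  have ac_ab_aa_bc (i j k l : Fin 4) (hn : [i, j, k, l].Nodup) :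
      W (e i) c (e j) b (e k) (e l) b c = 0 :=
    hW.flip₄ (by
      simpa [hW.flip₄ (ac_aa_ab_bc i j l k (by grind)),
        hW.flip₄ (ac_ab_ab_ac i j k l hn)]
        using hW.f₁' (e i) c (e j) (e k) c (e l) b)
  have ac_ab_bc_aa (i j k l : Fin 4) (hn : [i, j, k, l].Nodup) :
      W (e i) c (e j) b b c (e k) (e l) = 0 :=
    hW.flip₃ (by
      simpa [hW.flip₃ (ac_aa_bc_ab i j l k (by grind)),
        hW.flip₃ (ac_ab_ac_ab i j l k (by grind))]
        using hW.f₁' (e i) c (e j) c (e k) (e l) b)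
  have ac_bc_ab_aa (i j k l : Fin 4) (hn : [i, j, k, l].Nodup) :
      W (e i) c b c (e j) b (e k) (e l) = 0 :=
    hW.flip₂ (by
      simpa [hW.flip₂ (ac_ac_ab_ab i l j k (by grind)),
        hW.flip₂ (ac_bc_aa_ab i j l k (by grind))]
        using hW.f₁' (e i) c c (e j) (e k) (e l) b)
  have bc_ac_ab_aa (i j k l : Fin 4) (hn : [i, j, k, l].Nodup) :
      W b c (e i) c (e j) b (e k) (e l) = 0 :=
    hW.bc_ac₁ (ac_bc_ab_aa i j k l hn)
  have bc_aa_aa_bc (i j k l : Fin 4) (hn : [i, j, k, l].Nodup) :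
      W b c (e i) (e j) (e k) (e l) b c = 0 := by
    simpa [aa_bc_aa_bc i j k l hn,
      ab_ac_aa_bc i j k l hn,
      ac_ab_aa_bc j i k l (by grind)]
      using hW.X₁ (e i) (e j) b c (e k) (e l) b c
  have ab_ac_bc_aa (i j k l : Fin 4) (hn : [i, j, k, l].Nodup) :
      W (e i) b (e j) c b c (e k) (e l) = 0 := by
    simpa [ac_ab_bc_aa i j k l hn]
      using hW.r (e i) (e j) b c (e k) (e l)
  have ab_bc_ac_aa (i j k l : Fin 4) (hn : [i, j, k, l].Nodup) :
      W (e i) b b c (e j) c (e k) (e l) = 0 :=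
    hW.bc_ac₂ (ab_ac_bc_aa i j k l hn)
  have ab_ac_ab_ac (i j k l : Fin 4) (hn : [i, j, k, l].Nodup) :
      W (e i) b (e j) c (e k) b (e l) c = 0 := by
    simpa [ab_ac_aa_bc i j k l hn,
      ab_ac_ac_ab i j l k (by grind),
      ab_ac_bc_aa i j k l hn]
      using hW.X₃ (e i) b (e j) c (e k) (e l) b c
  have bc_aa_bc_aa (i j k l : Fin 4) (hn : [i, j, k, l].Nodup) :
      W b c (e i) (e j) b c (e k) (e l) = 0 := by
    simpa [aa_bc_bc_aa i j k l hn,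
      ab_ac_bc_aa i j k l hn,
      ac_ab_bc_aa j i k l (by grind)]
      using hW.X₁ (e i) (e j) b c b c (e k) (e l)
  have bc_ab_ac_aa (i j k l : Fin 4) (hn : [i, j, k, l].Nodup) :
      W b c (e i) b (e j) c (e k) (e l) = 0 :=
    hW.bc_ab₁ (ab_bc_ac_aa i j k l hn)
  have ab_bc_aa_ac (i j k l : Fin 4) (hn : [i, j, k, l].Nodup) :
      W (e i) b b c (e j) (e k) (e l) c = 0 := by
    simpa [ab_aa_bc_ac i j k l hn,
      ab_ab_ac_ac i j k l hn,
      ab_ac_ab_ac i k j l (by grind)]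
      using hW.X₂ (e i) b (e j) (e k) b c (e l) c
  have bc_aa_ab_ac (i j k l : Fin 4) (hn : [i, j, k, l].Nodup) :
      W b c (e i) (e j) (e k) b (e l) c = 0 := by
    simpa [aa_bc_ab_ac i j k l hn,
      ab_ac_ab_ac i j k l hn,
      ac_ab_ab_ac j i k l (by grind)]
      using hW.X₁ (e i) (e j) b c (e k) b (e l) c
  have bc_bc_aa_aa (i j k l : Fin 4) (hn : [i, j, k, l].Nodup) :
      W b c b c (e i) (e j) (e k) (e l) = 0 := by
    simpa [bc_aa_bc_aa i j k l hn,
      bc_ab_ac_aa i j k l hn,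
      bc_ac_ab_aa j i k l (by grind)]
      using hW.X₂ b c (e i) (e j) b c (e k) (e l)
  have bc_ab_aa_ac (i j k l : Fin 4) (hn : [i, j, k, l].Nodup) :
      W b c (e i) b (e j) (e k) (e l) c = 0 :=
    hW.bc_ab₁ (ab_bc_aa_ac i j k l hn)
  set φ := letter e b c
  set L : List (Fin 4 ⊕ Bool) := [.inl 0, .inl 1, .inl 2, .inl 3,
    .inr false, .inr false, .inr true, .inr true]
  revert hl
  refine forall_pair
    (P := fun u v => [u, v, l₃, l₄, l₅, l₆, l₇, l₈].Perm L →
      W (φ u) (φ v) (φ l₃) (φ l₄) (φ l₅) (φ l₆) (φ l₇) (φ l₈) = 0)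
    (fun u _ => hW.alt₁ _ _ _ _ _ _ _)
    (fun u v h hl => hW.flip₁ (h (.trans (.swap _ _ _) hl))) (fun s₁ => ?_) l₁ l₂
  refine forall_pair
    (P := fun u v => [s₁.fst, s₁.snd, u, v, l₅, l₆, l₇, l₈].Perm L →
      W (φ s₁.fst) (φ s₁.snd) (φ u) (φ v) (φ l₅) (φ l₆) (φ l₇) (φ l₈) = 0)
    (fun u _ => hW.alt₂ _ _ _ _ _ _ _)
    (fun u v h hl => hW.flip₂ (h (.trans (.cons _ (.cons _ (.swap _ _ _))) hl)))
    (fun s₂ => ?_) l₃ l₄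
  refine forall_pair
    (P := fun u v => [s₁.fst, s₁.snd, s₂.fst, s₂.snd, u, v, l₇, l₈].Perm L →
      W (φ s₁.fst) (φ s₁.snd) (φ s₂.fst) (φ s₂.snd) (φ u) (φ v) (φ l₇) (φ l₈) = 0)
    (fun u _ => hW.alt₃ _ _ _ _ _ _ _)
    (fun u v h hl => hW.flip₃ (h (.trans (.cons _ (.cons _ (.cons _ (.cons _ (.swap _ _ _))))) hl)))
    (fun s₃ => ?_) l₅ l₆
  refine forall_pair
    (P := fun u v => [s₁.fst, s₁.snd, s₂.fst, s₂.snd, s₃.fst, s₃.snd, u, v].Perm L →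
      W (φ s₁.fst) (φ s₁.snd) (φ s₂.fst) (φ s₂.snd) (φ s₃.fst) (φ s₃.snd) (φ u) (φ v) = 0)
    (fun u _ => hW.alt₄ _ _ _ _ _ _ _)
    (fun u v h hl => hW.flip₄ (h (.trans
      (.cons _ (.cons _ (.cons _ (.cons _ (.cons _ (.cons _ (.swap _ _ _))))))) hl)))
    (fun s₄ => ?_) l₇ l₈
  intro hl
  have hb : _ = 2 := hl.count_eq (.inr false)
  have hc : _ = 2 := hl.count_eq (.inr true)
  have ha := (hl.filterMap Sum.getLeft?).nodup_iff.2 (by decide)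
  clear hl h₁ h₂ h₃ h₄ h₅ h₆ h₇
  cases s₁ <;> cases s₂ <;> cases s₃ <;> cases s₄ <;>
    first
    | (cases hb; done)
    | (cases hc; done)
    | (apply_assumption; exact ha)

end WordRelations

/-- The values at `x` of iterated products of an alternating trilinear map satisfy
`WordRelations`. -/
theorem WordRelations.of_trilinear {M N : Type*} [AddCommGroup M] [Module (ZMod 3) M]
    [AddCommGroup N] [Module (ZMod 3) N]
    (T : M →ₗ[ZMod 3] M →ₗ[ZMod 3] M →ₗ[ZMod 3] M) (φ : M →ₗ[ZMod 3] N) (x : M)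
    (halt : ∀ x y z : M, x = y ∨ y = z ∨ x = z → T x y z = 0)
    (hX : ∀ x i j p q : M,
      T (T x i j) p q + T (T x i p) j q + T (T x j q) i p + T (T x p q) i j = 0)
    (hf₁ : ∀ x i j p q a : M,
      T (T (T x i q) j a) p a + T (T (T x i a) j q) p a + T (T (T x i a) j a) p q = 0)
    (hf₂ : ∀ x i j p q a : M,
      T (T (T x p i) j a) a q + T (T (T x p j) i a) a q
        + T (T (T x q i) j a) a p + T (T (T x q j) i a) a p = 0)
    (hg₁ : ∀ x i j p q a b : M,
      T (T (T x i q) j a) p b + T (T (T x i q) j b) p a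
        + T (T (T x i a) j q) p b + T (T (T x i b) j q) p a
        + T (T (T x i a) j b) p q + T (T (T x i b) j a) p q = 0)
    (hg₂ : ∀ x i j p q a b : M,
      T (T (T x p i) j a) b q + T (T (T x p i) j b) a q
        + T (T (T x p j) i a) b q + T (T (T x p j) i b) a q
        + T (T (T x q i) j a) b p + T (T (T x q i) j b) a p
        + T (T (T x q j) i a) b p + T (T (T x q j) i b) a p = 0)
    (hg₃ : ∀ x a₁ a₂ a₃ a₄ b c : M,
      T (T (T (T x a₂ a₄) a₁ b) a₃ c) b c + T (T (T (T x a₂ a₃) a₁ b) a₄ c) b c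
        + T (T (T (T x a₁ a₄) a₂ b) a₃ c) b c
        + T (T (T (T x a₁ a₃) a₂ b) a₄ c) b c = 0)
    (hr : ∀ x i j b c : M,
      T (T (T x i c) j b) b c + T (T (T x i b) j c) b c = 0) :
    WordRelations fun i j k l m n p q => φ (T (T (T (T x i j) k l) m n) p q) := by
  have alt (x y : M) : T x y y = 0 := halt x y y (.inr (.inl rfl))
  have skew (x y z : M) : T x z y = -T x y z := by
    have h := alt x (y + z)
    simp only [map_add, LinearMap.add_apply, alt, zero_add, add_zero] at h
    exact eq_neg_of_add_eq_zero_left h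
  have half {v : M} (h : v + v = 0) : v = 0 := by
    have h₃ : (3 : ZMod 3) • v = 0 := by rw [show (3 : ZMod 3) = 0 from rfl, zero_smul]
    rw [show (3 : ZMod 3) = 1 + 1 + 1 from rfl, add_smul, add_smul, one_smul, h, zero_add] at h₃
    exact h₃
  have sq (x b c : M) : T (T x b c) b c = 0 :=
    half (by simpa [alt] using hX x b b c c)
  have f₂ (x i j p a : M) : T (T (T x p i) j a) a p + T (T (T x p j) i a) a p = 0 :=
    half (by simpa [add_assoc] using hf₂ x i j p p a)
  exact
    { skew₁ := fun i j k l m n p q => by simp [skew x i j]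
      skew₂ := fun i j k l m n p q => by simp [skew (T x i j) k l]
      skew₃ := fun i j k l m n p q => by simp [skew (T (T x i j) k l) m n]
      skew₄ := fun i j k l m n p q => by simp [skew (T (T (T x i j) k l) m n) p q]
      alt₁ := by simp [alt]
      alt₂ := by simp [alt]
      alt₃ := by simp [alt]
      alt₄ := by simp [alt]
      X₁ := fun i j p q k l m n => by
        simpa using congrArg (fun v => φ (T (T v k l) m n)) (hX x i j p q)
      X₂ := fun k l i j p q m n => by
        simpa using congrArg (fun v => φ (T v m n)) (hX (T x k l) i j p q)
      X₃ := fun k l m n i j p q => by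
        simpa using congrArg φ (hX (T (T x k l) m n) i j p q)
      f₁ := fun i j p q a m n => by
        simpa using congrArg (fun v => φ (T v m n)) (hf₁ x i j p q a)
      f₁' := fun m n i j p q a => by
        simpa using congrArg φ (hf₁ (T x m n) i j p q a)
      f₂ := fun m n i j p a => by
        simpa using congrArg φ (f₂ (T x m n) i j p a)
      g₁ := fun i j p q a b m n => by
        simpa using congrArg (fun v => φ (T v m n)) (hg₁ x i j p q a b)
      g₂ := fun i j p q a b m n => by
        simpa using congrArg (fun v => φ (T v m n)) (hg₂ x i j p q a b)
      g₃ := fun a₁ a₂ a₃ a₄ b c => by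
        simpa using congrArg φ (hg₃ x a₁ a₂ a₃ a₄ b c)
      sq := by simp [sq]
      r := fun i j b c m n => by
        simpa using congrArg (fun v => φ (T v m n)) (hr x i j b c)
      r' := fun m n i j b c => by
        simpa using congrArg φ (hr (T x m n) i j b c) }

/-- Let `M` be a vector space over `𝔽₃` and `T` an alternating
trilinear map satisfying (X), (f₁), (f₂), (g₁), (g₂), (g₃), (s₂) and (r).
Then, with `(w₁,…,w₈) = (a₁,a₂,a₃,a₄,b,b,c,c)`, every permuted word
`T(T(T(T(x,w_{σ1},w_{σ2}),w_{σ3},w_{σ4}),w_{σ5},w_{σ6}),w_{σ7},w_{σ8})`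
lies in the span of the seven elements `v₁,…,v₇` of Lemma 7 of the paper. -/
theorem stmt_19 (M : Type*) [AddCommGroup M] [Module (ZMod 3) M]
    (T : M →ₗ[ZMod 3] M →ₗ[ZMod 3] M →ₗ[ZMod 3] M)
    (halt : ∀ x y z : M, x = y ∨ y = z ∨ x = z → T x y z = 0)
    (hX : ∀ x i j p q : M,
      T (T x i j) p q + T (T x i p) j q + T (T x j q) i p + T (T x p q) i j = 0)
    (hf₁ : ∀ x i j p q a : M,
      T (T (T x i q) j a) p a + T (T (T x i a) j q) p a + T (T (T x i a) j a) p q = 0)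
    (hf₂ : ∀ x i j p q a : M,
      T (T (T x p i) j a) a q + T (T (T x p j) i a) a q
        + T (T (T x q i) j a) a p + T (T (T x q j) i a) a p = 0)
    (hg₁ : ∀ x i j p q a b : M,
      T (T (T x i q) j a) p b + T (T (T x i q) j b) p a
        + T (T (T x i a) j q) p b + T (T (T x i b) j q) p a
        + T (T (T x i a) j b) p q + T (T (T x i b) j a) p q = 0)
    (hg₂ : ∀ x i j p q a b : M,
      T (T (T x p i) j a) b q + T (T (T x p i) j b) a q
        + T (T (T x p j) i a) b q + T (T (T x p j) i b) a q
        + T (T (T x q i) j a) b p + T (T (T x q i) j b) a p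
        + T (T (T x q j) i a) b p + T (T (T x q j) i b) a p = 0)
    (hg₃ : ∀ x a₁ a₂ a₃ a₄ b c : M,
      T (T (T (T x a₂ a₄) a₁ b) a₃ c) b c + T (T (T (T x a₂ a₃) a₁ b) a₄ c) b c
        + T (T (T (T x a₁ a₄) a₂ b) a₃ c) b c
        + T (T (T (T x a₁ a₃) a₂ b) a₄ c) b c = 0)
    (hs₂ : ∀ x u v b c : M, T (T (T (T x u v) u b) v c) b c = 0)
    (hr : ∀ x i j b c : M,
      T (T (T x i c) j b) b c + T (T (T x i b) j c) b c = 0)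
    (x a₁ a₂ a₃ a₄ b c : M) (σ : Equiv.Perm (Fin 8)) :
    T (T (T (T x (![a₁, a₂, a₃, a₄, b, b, c, c] (σ 0)) (![a₁, a₂, a₃, a₄, b, b, c, c] (σ 1)))
            (![a₁, a₂, a₃, a₄, b, b, c, c] (σ 2)) (![a₁, a₂, a₃, a₄, b, b, c, c] (σ 3)))
          (![a₁, a₂, a₃, a₄, b, b, c, c] (σ 4)) (![a₁, a₂, a₃, a₄, b, b, c, c] (σ 5)))
        (![a₁, a₂, a₃, a₄, b, b, c, c] (σ 6)) (![a₁, a₂, a₃, a₄, b, b, c, c] (σ 7)) ∈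
      Submodule.span (ZMod 3)
        ({T (T (T (T x a₁ a₂) a₃ b) a₄ c) b c,
          T (T (T (T x a₁ a₃) a₂ b) a₄ c) b c,
          T (T (T (T x a₂ a₃) a₁ b) a₄ c) b c,
          T (T (T (T x a₁ a₄) a₂ b) a₃ c) b c,
          T (T (T (T x a₁ b) a₂ a₃) a₄ c) b c,
          T (T (T (T x a₁ c) a₂ a₃) a₄ b) b c,
          T (T (T (T x a₁ b) a₂ c) a₃ a₄) b c} : Set M) := by
  set S := Submodule.span (ZMod 3)
    ({T (T (T (T x a₁ a₂) a₃ b) a₄ c) b c,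
      T (T (T (T x a₁ a₃) a₂ b) a₄ c) b c,
      T (T (T (T x a₂ a₃) a₁ b) a₄ c) b c,
      T (T (T (T x a₁ a₄) a₂ b) a₃ c) b c,
      T (T (T (T x a₁ b) a₂ a₃) a₄ c) b c,
      T (T (T (T x a₁ c) a₂ a₃) a₄ b) b c,
      T (T (T (T x a₁ b) a₂ c) a₃ a₄) b c} : Set M)
  have hW := WordRelations.of_trilinear T S.mkQ x halt hX hf₁ hf₂ hg₁ hg₂ hg₃ hr
  let l : Fin 8 → Fin 4 ⊕ Bool := ![.inl 0, .inl 1, .inl 2, .inl 3,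
    .inr false, .inr false, .inr true, .inr true]
  have hl (n : Fin 8) : ![a₁, a₂, a₃, a₄, b, b, c, c] n =
      WordRelations.letter ![a₁, a₂, a₃, a₄] b c (l n) := by
    fin_cases n <;> rfl
  have mem {v : M} (hv : v ∈ ({T (T (T (T x a₁ a₂) a₃ b) a₄ c) b c,
      T (T (T (T x a₁ a₃) a₂ b) a₄ c) b c,
      T (T (T (T x a₂ a₃) a₁ b) a₄ c) b c,
      T (T (T (T x a₁ a₄) a₂ b) a₃ c) b c,
      T (T (T (T x a₁ b) a₂ a₃) a₄ c) b c,
      T (T (T (T x a₁ c) a₂ a₃) a₄ b) b c,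
      T (T (T (T x a₁ b) a₂ c) a₃ a₄) b c} : Set M)) : S.mkQ v = 0 := by
    simpa using Submodule.subset_span hv
  rw [← Submodule.Quotient.mk_eq_zero, ← Submodule.mkQ_apply]
  simp only [hl]
  exact hW.eq_zero_of_perm ![a₁, a₂, a₃, a₄] b c (mem (by simp)) (mem (by simp)) (mem (by simp))
    (mem (by simp)) (mem (by simp)) (mem (by simp)) (mem (by simp)) _ _ _ _ _ _ _ _
    (Equiv.Perm.ofFn_comp_perm σ l)
end
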